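/- (Eigenvalue master equation.) Let x > 0 be a real number that is not an eigenvalue of X̃ᵀX̃. Then the matrix x^{1/2}·[[0, X̃ᵀ],[X̃, 0]] − x·I_{p+r} is invertible, so G(x) is well defined; and x is an eigenvalue of ỸᵀỸ if and only if det( 𝒟^{−1} + x^{1/2}·AᵀG(x)A ) = 0, where the determinant is of a 2k×2k matrix. -/

import Mathlib

open Matrix

/-- A positive `x` avoids the spectrum of `MᵀM` iff the linearization of `M` at `x` is invertible. -/
theorem isUnit_linearization_iff {m n : Type*} [Fintype m] [Fintype n] [DecidableEq m]
    [DecidableEq n] (M : Matrix m n ℝ) {x : ℝ} (hx : 0 < x) :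
    IsUnit (Real.sqrt x • Matrix.fromBlocks 0 Mᵀ M 0 - x • (1 : Matrix (n ⊕ m) (n ⊕ m) ℝ)) ↔
      x ∉ spectrum ℝ (Mᵀ * M) := by
  have hs : Real.sqrt x ≠ 0 := (Real.sqrt_pos.2 hx).ne'
  have factor : Real.sqrt x • Matrix.fromBlocks 0 Mᵀ M 0 - x • (1 : Matrix (n ⊕ m) (n ⊕ m) ℝ) =
      Real.sqrt x • Matrix.fromBlocks (-(Real.sqrt x • 1)) Mᵀ M (-(Real.sqrt x • 1)) := by
    rw [← Matrix.fromBlocks_one]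
    simp [Matrix.fromBlocks_smul, sub_eq_add_neg, Matrix.fromBlocks_neg, Matrix.fromBlocks_add,
      smul_smul, -Matrix.fromBlocks_one, Real.mul_self_sqrt hx.le]
  let _ : Invertible (-(Real.sqrt x • (1 : Matrix m m ℝ))) :=
    ⟨-((Real.sqrt x)⁻¹ • 1), by simp [smul_smul, hs], by simp [smul_smul, hs]⟩
  have schur : (-(Real.sqrt x • (1 : Matrix n n ℝ))) - Mᵀ * ⅟(-(Real.sqrt x • (1 : Matrix m m ℝ))) * M =
      -(Real.sqrt x)⁻¹ • (algebraMap ℝ (Matrix n n ℝ) x - Mᵀ * M) := by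
    have h : ⅟(-(Real.sqrt x • (1 : Matrix m m ℝ))) = -((Real.sqrt x)⁻¹ • 1) := rfl
    have hx' : (Real.sqrt x)⁻¹ * x = Real.sqrt x := by
      rw [inv_mul_eq_iff_eq_mul₀ hs, Real.mul_self_sqrt hx.le]
    rw [h, Algebra.algebraMap_eq_smul_one]
    simp [smul_smul, hx', sub_eq_add_neg]
  have hD : (-(Real.sqrt x • (1 : Matrix m m ℝ))).det ≠ 0 :=
    ((Matrix.isUnit_iff_isUnit_det _).1 (isUnit_of_invertible _)).ne_zero
  rw [spectrum.notMem_iff, Matrix.isUnit_iff_isUnit_det, Matrix.isUnit_iff_isUnit_det,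
    isUnit_iff_ne_zero, isUnit_iff_ne_zero, factor, Matrix.det_smul, Matrix.det_fromBlocks₂₂,
    schur, Matrix.det_smul]
  simp only [mul_ne_zero_iff]
  simp only [ne_eq, hD, not_false_eq_true, true_and, pow_eq_zero_iff', hs, neg_eq_zero,
    inv_eq_zero, false_and]

/-- Invertibility of a low-rank perturbation, expressed through the inverse of the core. -/
theorem isUnit_add_smul_mul_mul_iff {K m n : Type*} [Field K] [Fintype m] [Fintype n]
    [DecidableEq m] [DecidableEq n] {L : Matrix m m K} (hL : IsUnit L) (s : K)
    (A : Matrix m n K) {C : Matrix n n K} (hC : IsUnit C) (B : Matrix n m K) :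
    IsUnit (L + s • (A * C * B)) ↔ (C⁻¹ + s • (B * L⁻¹ * A)).det ≠ 0 := by
  rw [Matrix.isUnit_iff_isUnit_det] at hL hC
  have hprod : L + s • (A * C * B) = L + A * (s • (C * B)) := by
    rw [Matrix.mul_smul, Matrix.mul_assoc]
  have core : 1 + s • (C * B) * L⁻¹ * A = C * (C⁻¹ + s • (B * L⁻¹ * A)) := by
    rw [Matrix.mul_add, Matrix.mul_nonsing_inv _ hC]
    simp only [Matrix.mul_smul, Matrix.smul_mul, Matrix.mul_assoc]
  rw [Matrix.isUnit_iff_isUnit_det, isUnit_iff_ne_zero, hprod, Matrix.det_add_mul _ _ hL, core,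
    Matrix.det_mul, mul_ne_zero_iff, mul_ne_zero_iff]
  simp [hL.ne_zero, hC.ne_zero]

/-- **Eigenvalue master equation.** Let `Ỹ = X̃ + V D Uᵀ`, `A = [[U,0],[0,V]]`,
`𝒟 = [[0,D],[D,0]]`. If `x > 0` is not an eigenvalue of `X̃ᵀX̃`, then the linearization
`x^{1/2}[[0,X̃ᵀ],[X̃,0]] − x I` is invertible (so `G(x)` is well defined), and `x` is an
eigenvalue of `ỸᵀỸ` if and only if `det(𝒟⁻¹ + x^{1/2} Aᵀ G(x) A) = 0`. -/
theorem eigenvalue_master_equation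
    {p r k : ℕ}
    (Xt : Matrix (Fin r) (Fin p) ℝ)
    (U : Matrix (Fin p) (Fin k) ℝ) (V : Matrix (Fin r) (Fin k) ℝ)
    (d : Fin k → ℝ) (hd : ∀ i, d i ≠ 0)
    (x : ℝ) (hx : 0 < x)
    (hx_notev : x ∉ spectrum ℝ (Xtᵀ * Xt)) :
    IsUnit (Real.sqrt x • Matrix.fromBlocks 0 Xtᵀ Xt 0 -
      x • (1 : Matrix (Fin p ⊕ Fin r) (Fin p ⊕ Fin r) ℝ)) ∧
    (x ∈ spectrum ℝ
        ((Xt + V * Matrix.diagonal d * Uᵀ)ᵀ * (Xt + V * Matrix.diagonal d * Uᵀ)) ↔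
      Matrix.det
        ((Matrix.fromBlocks 0 (Matrix.diagonal d) (Matrix.diagonal d) 0 :
            Matrix (Fin k ⊕ Fin k) (Fin k ⊕ Fin k) ℝ)⁻¹ +
          Real.sqrt x •
            ((Matrix.fromBlocks U 0 0 V)ᵀ *
              (Real.sqrt x • Matrix.fromBlocks 0 Xtᵀ Xt 0 -
                x • (1 : Matrix (Fin p ⊕ Fin r) (Fin p ⊕ Fin r) ℝ))⁻¹ *
              Matrix.fromBlocks U 0 0 V)) = 0) := by
  have hL := (isUnit_linearization_iff Xt hx).2 hx_notev
  refine ⟨hL, ?_⟩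
  have hC : IsUnit (Matrix.fromBlocks 0 (Matrix.diagonal d) (Matrix.diagonal d) 0 :
      Matrix (Fin k ⊕ Fin k) (Fin k ⊕ Fin k) ℝ) := by
    have hdd : Matrix.diagonal d * Matrix.diagonal (fun i => (d i)⁻¹) = 1 := by
      simp [Matrix.diagonal_mul_diagonal, hd]
    refine IsUnit.of_mul_eq_one (Matrix.fromBlocks 0 (Matrix.diagonal fun i => (d i)⁻¹)
      (Matrix.diagonal fun i => (d i)⁻¹) 0) ?_
    simp only [Matrix.fromBlocks_multiply, hdd, Matrix.zero_mul, Matrix.mul_zero, zero_add,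
      add_zero, Matrix.fromBlocks_one]
  have perturb : Real.sqrt x • Matrix.fromBlocks 0 (Xt + V * Matrix.diagonal d * Uᵀ)ᵀ
        (Xt + V * Matrix.diagonal d * Uᵀ) 0 -
        x • (1 : Matrix (Fin p ⊕ Fin r) (Fin p ⊕ Fin r) ℝ) =
      (Real.sqrt x • Matrix.fromBlocks 0 Xtᵀ Xt 0 - x • 1) +
        Real.sqrt x • (Matrix.fromBlocks U 0 0 V *
          Matrix.fromBlocks 0 (Matrix.diagonal d) (Matrix.diagonal d) 0 *
          (Matrix.fromBlocks U 0 0 V)ᵀ) := by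
    rw [sub_add_eq_add_sub, ← smul_add]
    simp [Matrix.fromBlocks_transpose, Matrix.fromBlocks_multiply, Matrix.fromBlocks_add,
      Matrix.transpose_mul, Matrix.mul_assoc]
  rw [← not_iff_not, ← isUnit_linearization_iff _ hx, perturb]
  exact isUnit_add_smul_mul_mul_iff hL _ _ hC _
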